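/- Let n ≥ 1 and d ≥ 1 be natural numbers. For every real μ > μ_{n,d} there exist k ∈ ℕ and hermitian complex k×k matrices X_1, …, X_n such that H_{2d}(X_1, …, X_n) − μ · (X_1^{2d} + ⋯ + X_n^{2d}) is not positive semidefinite. (The constant μ_{n,d} in the operator lower bound for the NCHS polynomial H_{2d} is best possible.) -/

import Mathlib

open Matrix BigOperators ComplexOrder

/-- Product of ring elements along a word `w : Fin d → Fin n`:
`X_{w 0} * X_{w 1} * ⋯ * X_{w (d-1)}`. -/
noncomputable def wordProd {R : Type*} [Monoid R] {n d : ℕ} (X : Fin n → R)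
    (w : Fin d → Fin n) : R :=
  (List.ofFn fun i => X (w i)).prod

/-- Number of occurrences of the letter `j` in the word `w`. -/
def letterCount {n d : ℕ} (w : Fin d → Fin n) (j : Fin n) : ℕ :=
  (Finset.univ.filter fun i => w i = j).card

/-- Coefficient of the word `w` in the NCHS polynomial of degree `d`:
`(∏_j k_j(w)!) / d!`. -/
noncomputable def nchsCoeff {n : ℕ} (d : ℕ) (w : Fin d → Fin n) : ℝ :=
  ((∏ j : Fin n, (letterCount w j).factorial : ℕ) : ℝ) / (d.factorial : ℝ)

/-- The noncommutative complete homogeneous symmetric polynomial of degree `d`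
evaluated at `X`. -/
noncomputable def nchs {R : Type*} [Ring R] [Module ℝ R] {n : ℕ} (d : ℕ)
    (X : Fin n → R) : R :=
  ∑ w : Fin d → Fin n, nchsCoeff d w • wordProd X w

/-- The optimal constant `μ_{n,d}`. -/
noncomputable def muConst (n d : ℕ) : ℝ :=
  if n = 1 then 1 else
    ((n - 1 + 2 * d).choose (2 * d) : ℝ) /
      (((n - 1 + d).choose d : ℝ) *
        (((n - 1 + d).choose d : ℝ) + if Odd d then 1 else ((n - 1 : ℕ) : ℝ)))

open PowerSeries in
lemma mk_neg_one_pow_multichoose_mul (r : ℕ) :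
    (PowerSeries.mk fun j => (-1 : ℝ) ^ j * (Nat.multichoose r j : ℝ)) * (1 + X) ^ r = 1 := by
  induction r with
  | zero =>
    ext j
    rcases j with _ | j
    · simp
    · simp [PowerSeries.coeff_one]
  | succ r ih =>
    rw [pow_succ', ← mul_assoc]
    refine Eq.trans (congrArg (· * (1 + X) ^ r) ?_) ih
    ext j
    rcases j with _ | j
    · simp [mul_add]
    · simp [mul_add, PowerSeries.coeff_succ_mul_X, Nat.multichoose_succ_succ, pow_succ]

open PowerSeries in
lemma coeff_X_pow_mul_one_add_X_pow (m i k : ℕ) :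
    PowerSeries.coeff k ((X : PowerSeries ℝ) ^ i * (1 + X) ^ m) =
      if i ≤ k then (m.choose (k - i) : ℝ) else 0 := by
  rw [PowerSeries.coeff_X_pow_mul']
  congr 1
  have h := Polynomial.coeff_one_add_X_pow ℝ m (k - i)
  rw [← h, ← Polynomial.coeff_coe]
  simp

open PowerSeries in
lemma mk_choose_mul_choose (D a : ℕ) :
    (PowerSeries.mk fun k => (D.choose k : ℝ) * ((a + k).choose k : ℝ)) =
      ∑ p ∈ Finset.HasAntidiagonal.antidiagonal a, PowerSeries.C ((a.choose p.1 : ℝ) * (D.choose p.2 : ℝ)) *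
        (X ^ p.2 * (1 + X) ^ (D - p.2)) := by
  ext k
  rw [map_sum]
  simp only [PowerSeries.coeff_mk, PowerSeries.coeff_C_mul, coeff_X_pow_mul_one_add_X_pow]
  rw [← Nat.choose_symm_add, Nat.add_choose_eq, Nat.cast_sum, Finset.mul_sum]
  refine Finset.sum_congr rfl fun p _ => ?_
  split_ifs with h
  · have := Nat.choose_mul (n := D) h
    rw [mul_assoc, ← Nat.cast_mul (D.choose p.2), ← this]
    push_cast; ring
  · rw [Nat.choose_eq_zero_of_lt (not_le.mp h)]; simp

open PowerSeries in
lemma sum_choose_mul_choose_mul_multichoose {D a : ℕ} (d : ℕ) (had : a ≤ d) (haD : a ≤ D) :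
    ∑ p ∈ Finset.HasAntidiagonal.antidiagonal d, (D.choose p.1 : ℝ) * ((a + p.1).choose p.1 : ℝ) *
      ((-1) ^ p.2 * (Nat.multichoose (D - a) p.2 : ℝ)) =
      if a = d then ((D + d).choose d : ℝ) else 0 := by
  have h := PowerSeries.coeff_mul d
    (PowerSeries.mk fun k => (D.choose k : ℝ) * ((a + k).choose k : ℝ))
    (PowerSeries.mk fun j => (-1 : ℝ) ^ j * (Nat.multichoose (D - a) j : ℝ))
  simp only [PowerSeries.coeff_mk] at h
  rw [← h, mk_choose_mul_choose, Finset.sum_mul, map_sum]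
  have key : ∀ p ∈ Finset.HasAntidiagonal.antidiagonal a,
      PowerSeries.coeff d (PowerSeries.C ((a.choose p.1 : ℝ) * (D.choose p.2 : ℝ)) *
        (X ^ p.2 * (1 + X) ^ (D - p.2)) *
        (PowerSeries.mk fun j => (-1 : ℝ) ^ j * (Nat.multichoose (D - a) j : ℝ))) =
      if a = d then (a.choose p.1 : ℝ) * (D.choose p.2 : ℝ) else 0 := by
    intro p hp
    have hp' := Finset.HasAntidiagonal.mem_antidiagonal.mp hp
    have h1 : D - p.2 = p.1 + (D - a) := by omega
    rw [h1, pow_add]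
    have h2 := mk_neg_one_pow_multichoose_mul (D - a)
    have h3 : PowerSeries.C ((a.choose p.1 : ℝ) * (D.choose p.2 : ℝ)) *
        (X ^ p.2 * ((1 + X) ^ p.1 * (1 + X) ^ (D - a))) *
        (PowerSeries.mk fun j => (-1 : ℝ) ^ j * (Nat.multichoose (D - a) j : ℝ)) =
        PowerSeries.C ((a.choose p.1 : ℝ) * (D.choose p.2 : ℝ)) * (X ^ p.2 * (1 + X) ^ p.1) := by
      linear_combination (PowerSeries.C ((a.choose p.1 : ℝ) * (D.choose p.2 : ℝ)) *
        (X ^ p.2 * (1 + X) ^ p.1)) * h2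
    rw [h3, PowerSeries.coeff_C_mul, coeff_X_pow_mul_one_add_X_pow, if_pos (by omega)]
    split_ifs with had'
    · rw [show d - p.2 = p.1 by omega]; simp
    · rw [Nat.choose_eq_zero_of_lt (show p.1 < d - p.2 by omega)]; simp
  rw [Finset.sum_congr rfl key]
  split_ifs with had'
  · subst had'
    rw [add_comm D, Nat.add_choose_eq]
    push_cast; rfl
  · simp

lemma letterCount_eq_sum {n d : ℕ} (w : Fin d → Fin n) (j : Fin n) :
    letterCount w j = ∑ i, if w i = j then 1 else 0 := by
  simp [letterCount]

lemma letterCount_cons {n d : ℕ} (i : Fin n) (w : Fin d → Fin n) (j : Fin n) :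
    letterCount (Fin.cons i w : Fin (d + 1) → Fin n) j =
      letterCount w j + if i = j then 1 else 0 := by
  simp only [letterCount_eq_sum, Fin.sum_univ_succ, Fin.cons_zero, Fin.cons_succ]
  ring

lemma letterCount_append {n d e : ℕ} (u : Fin d → Fin n) (w : Fin e → Fin n) (j : Fin n) :
    letterCount (Fin.append u w) j = letterCount u j + letterCount w j := by
  simp only [letterCount_eq_sum, Fin.sum_univ_add, Fin.append_left, Fin.append_right]

lemma sum_letterCount {n d : ℕ} (w : Fin d → Fin n) : ∑ j, letterCount w j = d := by
  simp only [letterCount_eq_sum]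
  rw [Finset.sum_comm]
  simp

lemma letterCount_eq_length_iff {n d : ℕ} (w : Fin d → Fin n) (j : Fin n) :
    letterCount w j = d ↔ w = fun _ => j := by
  rw [letterCount, funext_iff]
  conv_lhs => rhs; rw [← Finset.card_fin d]
  rw [Finset.card_filter_eq_iff]
  simp

lemma sum_fin_succ_words {n d : ℕ} (f : (Fin (d + 1) → Fin n) → ℝ) :
    ∑ w, f w = ∑ i, ∑ w : Fin d → Fin n, f (Fin.cons i w) := by
  rw [← Fintype.sum_prod_type']
  exact ((Fin.consEquiv fun _ : Fin (d + 1) => Fin n).sum_comp f).symm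

lemma sum_words_mul_prod_factorial {n : ℕ} (p : Fin n) (d : ℕ) (α : Fin n → ℕ) (g : ℕ → ℝ) :
    ∑ w : Fin d → Fin n, g (letterCount w p) * ∏ j, ((α j + letterCount w j).factorial : ℝ) =
      (∏ j, ((α j).factorial : ℝ)) * ∑ q ∈ Finset.HasAntidiagonal.antidiagonal d,
        (d.choose q.1 : ℝ) * (g q.1 * ((α p + 1).ascFactorial q.1 : ℝ) *
          ((∑ j ∈ Finset.univ.erase p, (α j + 1)).ascFactorial q.2 : ℝ)) := by
  induction d generalizing α g with
  | zero => simp [letterCount]; ring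
  | succ d ih =>
    rw [sum_fin_succ_words]
    simp only [letterCount_cons]
    set r := ∑ j ∈ Finset.univ.erase p, (α j + 1) with hr
    have hprod : ∀ i, ∏ j, ((α j + if i = j then 1 else 0).factorial : ℝ) =
        (α i + 1) * ∏ j, ((α j).factorial : ℝ) := by
      intro i
      rw [← Finset.mul_prod_erase _ _ (Finset.mem_univ i),
        ← Finset.mul_prod_erase _ (fun j => ((α j).factorial : ℝ)) (Finset.mem_univ i)]
      have : ∏ j ∈ Finset.univ.erase i, ((α j + if i = j then 1 else 0).factorial : ℝ) =
          ∏ j ∈ Finset.univ.erase i, ((α j).factorial : ℝ) :=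
        Finset.prod_congr rfl fun j hj => by simp [(Finset.ne_of_mem_erase hj).symm]
      rw [this]
      simp [Nat.factorial_succ]
      ring
    have step : ∀ i, ∑ w : Fin d → Fin n, g (letterCount w p + if i = p then 1 else 0) *
        ∏ j, ((α j + (letterCount w j + if i = j then 1 else 0)).factorial : ℝ) =
        (α i + 1) * (∏ j, ((α j).factorial : ℝ)) *
          ∑ q ∈ Finset.HasAntidiagonal.antidiagonal d,
        (d.choose q.1 : ℝ) * (g (q.1 + if i = p then 1 else 0) *
          ((α p + (if i = p then 1 else 0) + 1).ascFactorial q.1 : ℝ) *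
          ((∑ j ∈ Finset.univ.erase p, (α j + (if i = j then 1 else 0) + 1)).ascFactorial q.2
            : ℝ)) := by
      intro i
      rw [← hprod, ← ih (fun j => α j + if i = j then 1 else 0)
        (fun k => g (k + if i = p then 1 else 0))]
      refine Finset.sum_congr rfl fun w _ => congrArg _ (Finset.prod_congr rfl fun j _ => ?_)
      rw [add_right_comm, add_assoc]
    have hsum : ∀ i, i ≠ p →
        ∑ j ∈ Finset.univ.erase p, (α j + (if i = j then 1 else 0) + 1) = r + 1 := by
      intro i hi
      have h : ∀ j, α j + (if i = j then 1 else 0) + 1 = (α j + 1) + if i = j then 1 else 0 :=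
        fun j => add_right_comm _ _ _
      simp only [h]
      rw [Finset.sum_add_distrib, ← hr]
      simp [hi]
    have hsum' : ∑ j ∈ Finset.univ.erase p, (α j + (if p = j then 1 else 0) + 1) = r :=
      Finset.sum_congr rfl fun j hj => by simp [(Finset.ne_of_mem_erase hj).symm]
    rw [Finset.sum_congr rfl fun i _ => step i, ← Finset.add_sum_erase _ _ (Finset.mem_univ p),
      hsum']
    have hrest : ∀ i ∈ Finset.univ.erase p, (α i + 1 : ℝ) * (∏ j, ((α j).factorial : ℝ)) *
          ∑ q ∈ Finset.HasAntidiagonal.antidiagonal d,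
        (d.choose q.1 : ℝ) * (g (q.1 + if i = p then 1 else 0) *
          ((α p + (if i = p then 1 else 0) + 1).ascFactorial q.1 : ℝ) *
          ((∑ j ∈ Finset.univ.erase p, (α j + (if i = j then 1 else 0) + 1)).ascFactorial q.2
            : ℝ)) = ((α i + 1 : ℕ) : ℝ) * ((∏ j, ((α j).factorial : ℝ)) *
          ∑ q ∈ Finset.HasAntidiagonal.antidiagonal d,
        (d.choose q.1 : ℝ) * (g q.1 *
          ((α p + 1).ascFactorial q.1 : ℝ) * ((r + 1).ascFactorial q.2 : ℝ))) := by
      intro i hi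
      have hi' := Finset.ne_of_mem_erase hi
      rw [hsum i hi']
      simp only [if_neg hi', add_zero]
      push_cast; ring
    rw [Finset.sum_congr rfl hrest, ← Finset.sum_mul, ← Nat.cast_sum, ← hr,
      Finset.sum_antidiagonal_choose_succ_mul
        (fun k l => g k * ((α p + 1).ascFactorial k : ℝ) * (r.ascFactorial l : ℝ)) d]
    simp only [if_true]
    have e1 : ∀ k, (α p + 1 : ℝ) * ((α p + 1 + 1).ascFactorial k : ℝ) =
        ((α p + 1).ascFactorial (k + 1) : ℝ) := by
      intro k
      rw [Nat.ascFactorial_succ, ← Nat.succ_ascFactorial]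
      push_cast; ring
    have e2 : ∀ k, (r : ℝ) * ((r + 1).ascFactorial k : ℝ) = (r.ascFactorial (k + 1) : ℝ) := by
      intro k
      rw [Nat.ascFactorial_succ, ← Nat.succ_ascFactorial]
      push_cast; ring
    simp only [← e1, ← e2]
    rw [add_comm, mul_add, mul_left_comm]
    congr 1
    · simp only [Finset.mul_sum]
      exact Finset.sum_congr rfl fun q _ => by ring
    · simp only [Finset.mul_sum]
      refine Finset.sum_congr rfl fun q hq => ?_
      have hq' := Finset.HasAntidiagonal.mem_antidiagonal.mp hq
      rw [show d.choose q.2 = d.choose q.1 by rw [← hq', Nat.choose_symm_add]]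
      ring

/-- The value at a word with `k` occurrences of a letter `p` of the vector dual to the word
`p ⋯ p` of length `d` in `n` letters, for the Gram matrix `∏ⱼ (kⱼ(u) + kⱼ(w))!`. -/
noncomputable def dualWeight (n d k : ℕ) : ℝ :=
  (-1) ^ (d + k) * ((n - 1 + d).choose k : ℝ)

lemma sum_prod_factorial_mul_dualWeight {n d : ℕ} (p : Fin n) (u : Fin d → Fin n) :
    ∑ w : Fin d → Fin n, (∏ j, ((letterCount u j + letterCount w j).factorial : ℝ)) *
        dualWeight n d (letterCount w p) =
      if u = fun _ => p then
        (d.factorial : ℝ) * d.factorial * ((n - 1 + d + d).choose d : ℝ) else 0 := by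
  have h := sum_words_mul_prod_factorial p d (letterCount u) (dualWeight n d)
  simp only [mul_comm (dualWeight n d _)] at h
  rw [h]
  have hs := Finset.add_sum_erase Finset.univ (letterCount u) (Finset.mem_univ p)
  rw [sum_letterCount] at hs
  have hn : 1 ≤ n := p.pos
  have hr : ∑ j ∈ Finset.univ.erase p, (letterCount u j + 1) = n - 1 + d - letterCount u p := by
    rw [Finset.sum_add_distrib]
    simp
    omega
  rw [hr]
  have hterm : ∀ q ∈ Finset.HasAntidiagonal.antidiagonal d,
      (d.choose q.1 : ℝ) * (((letterCount u p + 1).ascFactorial q.1 : ℝ) * dualWeight n d q.1 *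
          ((n - 1 + d - letterCount u p).ascFactorial q.2 : ℝ)) =
      (d.factorial : ℝ) * (((n - 1 + d).choose q.1 : ℝ) *
        ((letterCount u p + q.1).choose q.1 : ℝ) *
        ((-1) ^ q.2 * (Nat.multichoose (n - 1 + d - letterCount u p) q.2 : ℝ))) := by
    intro q hq
    have hq' := Finset.HasAntidiagonal.mem_antidiagonal.mp hq
    rw [Nat.ascFactorial_eq_factorial_mul_choose, Nat.ascFactorial_eq_factorial_mul_choose',
      ← Nat.multichoose_eq, dualWeight]
    have hsign : (-1 : ℝ) ^ (d + q.1) = (-1) ^ q.2 := by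
      rw [show d + q.1 = 2 * q.1 + q.2 by omega, pow_add, pow_mul]
      simp
    have hfac : (d.factorial : ℝ) = d.choose q.1 * q.1.factorial * q.2.factorial := by
      rw [← hq', Nat.choose_symm_add, ← Nat.add_choose_mul_factorial_mul_factorial q.1 q.2]
      push_cast; ring
    rw [hsign, hfac]
    push_cast
    ring
  rw [Finset.sum_congr rfl hterm, ← Finset.mul_sum,
    sum_choose_mul_choose_mul_multichoose d (by omega) (by omega)]
  simp only [letterCount_eq_length_iff]
  split_ifs with hu
  · have hprod : ∏ j, ((letterCount u j).factorial : ℝ) = d.factorial := by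
      have hup : letterCount u p = d := (letterCount_eq_length_iff u p).mpr hu
      rw [← Finset.mul_prod_erase _ _ (Finset.mem_univ p), hup]
      have : ∀ j ∈ Finset.univ.erase p, ((letterCount u j).factorial : ℝ) = 1 := by
        intro j hj
        have := Finset.single_le_sum (f := letterCount u) (fun _ _ => Nat.zero_le _) hj
        rw [show letterCount u j = 0 by omega]
        simp
      rw [Finset.prod_congr rfl this]
      simp
    rw [hprod]; ring
  · simp

section FockSpace

variable {n d : ℕ}

/-- Index set of a truncated Fock space: the words of length less than `d`, together with one
additional vector in degree `d`. -/
abbrev FockIndex (n d : ℕ) : Type := Option {l : List (Fin n) // l.length < d}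

noncomputable instance : Fintype {l : List (Fin n) // l.length < d} :=
  (List.finite_length_lt (Fin n) d).fintype

/-- The sum of the creation and annihilation operators of the letter `j` on the words of length
less than `d`. -/
def fockLower (d : ℕ) (j : Fin n) : Matrix (FockIndex n d) (FockIndex n d) ℂ
  | some l, some m => if l.1 = j :: m.1 ∨ m.1 = j :: l.1 then 1 else 0
  | _, _ => 0

/-- The operator joining the words `m` of length `d - 1` to the top vector with weight
`a (j :: m)`. -/
noncomputable def fockTop (d : ℕ) (a : List (Fin n) → ℝ) (j : Fin n) :
    Matrix (FockIndex n d) (FockIndex n d) ℂ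
  | none, some m => if m.1.length + 1 = d then (a (j :: m.1) : ℂ) else 0
  | some m, none => if m.1.length + 1 = d then (a (j :: m.1) : ℂ) else 0
  | _, _ => 0

/-- The truncated Fock space operator whose top weights are scaled by `T`. -/
noncomputable def fockOp (d : ℕ) (a : List (Fin n) → ℝ) (T : ℝ) (j : Fin n) :
    Matrix (FockIndex n d) (FockIndex n d) ℂ :=
  fockLower d j + (T : ℂ) • fockTop d a j

/-- The vacuum vector. -/
def fockVacuum (hd : 0 < d) : FockIndex n d := some ⟨[], hd⟩

/-- The image of the vacuum under a word in the operators `fockLower`. -/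
noncomputable def fockVec (hd : 0 < d) : List (Fin n) → FockIndex n d → ℂ
  | [] => Pi.single (fockVacuum hd) 1
  | j :: w => fockLower d j *ᵥ fockVec hd w

lemma fockOp_transpose (a : List (Fin n) → ℝ) (T : ℝ) (j : Fin n) :
    (fockOp d a T j)ᵀ = fockOp d a T j := by
  ext x y
  rcases x with _ | x <;> rcases y with _ | y <;>
    simp [fockOp, fockLower, fockTop, or_comm]

lemma fockOp_isHermitian (a : List (Fin n) → ℝ) (T : ℝ) (j : Fin n) :
    (fockOp d a T j).IsHermitian := by
  ext x y
  rcases x with _ | x <;> rcases y with _ | y <;>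
    simp [fockOp, fockLower, fockTop, or_comm, apply_ite (starRingEnd ℂ)]

lemma fockVec_none (hd : 0 < d) (w : List (Fin n)) : fockVec hd w none = 0 := by
  cases w with
  | nil => simp [fockVec, fockVacuum]
  | cons j w => simp [fockVec, mulVec, dotProduct, fockLower]

lemma fockVec_some (hd : 0 < d) (w : List (Fin n)) (l : {l : List (Fin n) // l.length < d})
    (h : w.length ≤ l.1.length) : fockVec hd w (some l) = if l.1 = w then 1 else 0 := by
  induction w generalizing l with
  | nil => simp [fockVec, fockVacuum, Pi.single_apply, Subtype.ext_iff]
  | cons j w ih =>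
    rw [List.length_cons] at h
    have hterm : ∀ m : {l : List (Fin n) // l.length < d},
        fockLower d j (some l) (some m) * fockVec hd w (some m) =
          if l.1 = j :: w ∧ m.1 = w then 1 else 0 := by
      intro m
      by_cases h1 : l.1 = j :: m.1
      · have h2 : l.1.length = m.1.length + 1 := by rw [h1, List.length_cons]
        rw [ih m (by omega)]
        by_cases h3 : m.1 = w <;> simp [fockLower, h1, h3]
      · by_cases h2 : m.1 = j :: l.1
        · have h3 : m.1.length = l.1.length + 1 := by rw [h2, List.length_cons]
          have h4 : m.1 ≠ w := fun h => by rw [h] at h3; omega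
          rw [ih m (by omega)]
          simp [h4]
        · have h3 : ¬ (l.1 = j :: w ∧ m.1 = w) := fun h => h1 (by rw [h.1, h.2])
          simp [fockLower, h1, h2, h3]
    rw [fockVec, mulVec, dotProduct, Fintype.sum_option, fockVec_none, mul_zero, zero_add,
      Finset.sum_congr rfl fun m _ => hterm m]
    by_cases h1 : l.1 = j :: w
    · have h2 : w.length < d := by
        have := l.2
        omega
      rw [Finset.sum_eq_single (⟨w, h2⟩ : {l : List (Fin n) // l.length < d})]
      · simp [h1]
      · intro m _ hm
        rw [if_neg fun h => hm (Subtype.ext h.2)]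
      · simp
    · simp [h1]

lemma fockTop_mulVec_fockVec (hd : 0 < d) (a : List (Fin n) → ℝ) (j : Fin n) (w : List (Fin n))
    (h : w.length < d) :
    fockTop d a j *ᵥ fockVec hd w =
      Pi.single none (if w.length + 1 = d then (a (j :: w) : ℂ) else 0) := by
  ext x
  rcases x with _ | x
  · have hterm : ∀ m : {l : List (Fin n) // l.length < d},
        fockTop d a j none (some m) * fockVec hd w (some m) =
          if m = ⟨w, h⟩ then (if w.length + 1 = d then (a (j :: w) : ℂ) else 0) else 0 := by
      intro m
      by_cases h1 : m.1.length + 1 = d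
      · rw [fockVec_some hd w m (by omega)]
        by_cases h2 : m = ⟨w, h⟩
        · subst h2; simp [fockTop]
        · have h3 : m.1 ≠ w := fun h' => h2 (Subtype.ext h')
          simp [h2, h3]
      · have h2 : m = ⟨w, h⟩ → w.length + 1 ≠ d := by rintro rfl; exact h1
        by_cases h3 : m = ⟨w, h⟩
        · simp [fockTop, h1, h2 h3]
        · simp [fockTop, h1, h3]
    rw [mulVec, dotProduct, Fintype.sum_option, fockVec_none, mul_zero, zero_add,
      Finset.sum_congr rfl fun m _ => hterm m]
    simp
  · simp [mulVec, dotProduct, fockTop, fockVec_none]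

lemma fockOp_prod_mulVec (hd : 0 < d) (a : List (Fin n) → ℝ) (T : ℝ) (w : List (Fin n))
    (h : w.length ≤ d) :
    (w.map (fockOp d a T)).prod *ᵥ Pi.single (fockVacuum hd) 1 =
      fockVec hd w + Pi.single none (if w.length = d then (T * a w : ℂ) else 0) := by
  induction w with
  | nil =>
    rw [List.map_nil, List.prod_nil, one_mulVec]
    simp [fockVec, hd.ne]
  | cons j w ih =>
    rw [List.length_cons] at h
    rw [List.map_cons, List.prod_cons, ← mulVec_mulVec, ih (by omega), if_neg (by omega),
      Pi.single_zero, add_zero, fockOp, add_mulVec, smul_mulVec, fockTop_mulVec_fockVec _ _ _ _ h,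
      fockVec, ← Pi.single_smul]
    simp

lemma fockOp_prod_mul_prod_vacuum (hd : 0 < d) (a : List (Fin n) → ℝ) (T : ℝ)
    (u w : List (Fin n)) (hu : u.length = d) (hw : w.length = d) :
    ((u.map (fockOp d a T)).prod * (w.map (fockOp d a T)).prod) (fockVacuum hd) (fockVacuum hd) =
      fockVec hd u.reverse ⬝ᵥ fockVec hd w + ((T ^ 2 * (a u.reverse * a w) : ℝ) : ℂ) := by
  have h1 : ((u.map (fockOp d a T)).prod)ᵀ = (u.reverse.map (fockOp d a T)).prod := by
    rw [transpose_list_prod, List.map_map, List.map_reverse]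
    congr 2
    exact List.map_congr_left fun j _ => fockOp_transpose a T j
  have h2 : ((u.map (fockOp d a T)).prod * (w.map (fockOp d a T)).prod)
      (fockVacuum hd) (fockVacuum hd) =
      ((u.reverse.map (fockOp d a T)).prod *ᵥ Pi.single (fockVacuum hd) 1) ⬝ᵥ
        ((w.map (fockOp d a T)).prod *ᵥ Pi.single (fockVacuum hd) 1) := by
    rw [← h1]
    simp [Matrix.mul_apply, dotProduct]
  rw [h2, fockOp_prod_mulVec hd a T _ (by simp [hu]), fockOp_prod_mulVec hd a T _ hw.le]
  simp only [add_dotProduct, dotProduct_add, Pi.add_apply, single_dotProduct, dotProduct_single, fockVec_none,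
    List.length_reverse, hu, hw, if_true, Pi.single_eq_same]
  push_cast
  ring

end FockSpace

/-- For every weight `a` on words there are hermitian matrices, depending on a parameter `T`, for
which the diagonal entry of a product of two words of length `d` is, up to a term
independent of `T`, equal to `T²` times a rank one kernel. -/
lemma exists_hermitian_words_entry {n d : ℕ} (hd : 0 < d) (a : List (Fin n) → ℝ) :
    ∃ (k : ℕ) (e : Fin k) (X : ℝ → Fin n → Matrix (Fin k) (Fin k) ℂ)
      (F : List (Fin n) → List (Fin n) → ℂ), (∀ T j, (X T j).IsHermitian) ∧
      ∀ (T : ℝ) (u w : List (Fin n)), u.length = d → w.length = d →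
        ((u.map (X T)).prod * (w.map (X T)).prod) e e =
          F u w + ((T ^ 2 * (a u.reverse * a w) : ℝ) : ℂ) := by
  let f := Fintype.equivFin (FockIndex n d)
  refine ⟨_, f (fockVacuum hd), fun T j => reindexAlgEquiv ℂ ℂ f (fockOp d a T j),
    fun u w => fockVec hd u.reverse ⬝ᵥ fockVec hd w, fun T j => ?_, fun T u w hu hw => ?_⟩
  · exact (fockOp_isHermitian a T j).submatrix _
  · rw [← fockOp_prod_mul_prod_vacuum hd a T u w hu hw]
    have h : ∀ v : List (Fin n),
        (v.map fun j => reindexAlgEquiv ℂ ℂ f (fockOp d a T j)).prod =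
          reindexAlgEquiv ℂ ℂ f (v.map (fockOp d a T)).prod := by
      intro v
      rw [map_list_prod, List.map_map]
      rfl
    rw [h, h, ← map_mul]
    simp

lemma letterCount_eq_count_ofFn {n d : ℕ} (w : Fin d → Fin n) (j : Fin n) :
    letterCount w j = (List.ofFn w).count j := by
  induction d with
  | zero => simp [letterCount]
  | succ d ih =>
    rw [List.ofFn_succ, List.count_cons, ← ih, letterCount_eq_sum, letterCount_eq_sum,
      Fin.sum_univ_succ, add_comm]
    simp

lemma wordProd_eq_prod_map {R : Type*} [Monoid R] {n d : ℕ} (X : Fin n → R) (w : Fin d → Fin n) :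
    wordProd X w = ((List.ofFn w).map X).prod := by
  rw [wordProd, List.map_ofFn]
  rfl

lemma nchs_add_self {R : Type*} [Ring R] [Module ℝ R] {n : ℕ} (d : ℕ) (X : Fin n → R) :
    nchs (d + d) X = ∑ u : Fin d → Fin n, ∑ w : Fin d → Fin n,
      nchsCoeff (d + d) (Fin.append u w) •
        (((List.ofFn u).map X).prod * ((List.ofFn w).map X).prod) := by
  rw [← Fintype.sum_prod_type', nchs, ← (Fin.appendEquiv d d).sum_comp]
  refine Finset.sum_congr rfl fun p _ => ?_
  have hp : Fin.appendEquiv d d p = Fin.append p.1 p.2 := rfl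
  rw [wordProd_eq_prod_map, hp, List.ofFn_fin_append, List.map_append,
    List.prod_append]

lemma nchsCoeff_append {n d : ℕ} (u w : Fin d → Fin n) :
    nchsCoeff (d + d) (Fin.append u w) =
      (∏ j, ((letterCount u j + letterCount w j).factorial : ℝ)) / ((d + d).factorial : ℝ) := by
  simp only [nchsCoeff, letterCount_append, Nat.cast_prod]

lemma letterCount_const {n d : ℕ} (i j : Fin n) :
    letterCount (fun _ : Fin d => i) j = if i = j then d else 0 := by
  by_cases h : i = j <;> simp [letterCount, h]

/-- If the Gram form of `H_{2d}` is smaller than `μ` times that of the pure powers at some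
reversal-invariant weight, then the operator inequality fails. -/
lemma exists_not_posSemidef {n d : ℕ} (hd : 0 < d) (μ : ℝ) (a : List (Fin n) → ℝ)
    (ha : ∀ l, a l.reverse = a l)
    (hneg : ∑ u : Fin d → Fin n, ∑ w : Fin d → Fin n, nchsCoeff (d + d) (Fin.append u w) *
      (a (List.ofFn u) * a (List.ofFn w)) < μ * ∑ j, a (List.replicate d j) ^ 2) :
    ∃ (k : ℕ) (X : Fin n → Matrix (Fin k) (Fin k) ℂ),
      (∀ j, (X j).IsHermitian) ∧
      ¬ (nchs (2 * d) X - μ • ∑ j : Fin n, X j ^ (2 * d)).PosSemidef := by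
  obtain ⟨k, e, X, F, hX, hF⟩ := exists_hermitian_words_entry hd a
  set Q := ∑ u : Fin d → Fin n, ∑ w : Fin d → Fin n, nchsCoeff (d + d) (Fin.append u w) *
      (a (List.ofFn u) * a (List.ofFn w)) with hQ
  set E := ∑ j, a (List.replicate d j) ^ 2 with hE
  set B : ℂ := ∑ u : Fin d → Fin n, ∑ w : Fin d → Fin n,
      (nchsCoeff (d + d) (Fin.append u w) : ℂ) * F (List.ofFn u) (List.ofFn w) -
      μ * ∑ j, F (List.replicate d j) (List.replicate d j) with hB
  have hentry : ∀ T : ℝ, (nchs (2 * d) (X T) - μ • ∑ j : Fin n, X T j ^ (2 * d)) e e =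
      B + ((T ^ 2 * (Q - μ * E) : ℝ) : ℂ) := by
    intro T
    have hpow : ∀ j, (X T j ^ (d + d)) e e = F (List.replicate d j) (List.replicate d j) +
        ((T ^ 2 * a (List.replicate d j) ^ 2 : ℝ) : ℂ) := by
      intro j
      have h := hF T (List.replicate d j) (List.replicate d j) (by simp) (by simp)
      rw [List.map_replicate, List.prod_replicate, ← pow_add, ha] at h
      rw [h, sq (a _)]
    rw [Matrix.sub_apply, Matrix.smul_apply, Matrix.sum_apply, two_mul, nchs_add_self,
      Matrix.sum_apply]
    simp only [hpow, Matrix.sum_apply, Matrix.smul_apply,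
      hF T _ _ (List.length_ofFn) (List.length_ofFn), ha, Complex.real_smul]
    rw [hB, hQ, hE]
    push_cast
    simp only [mul_add, mul_sub, Finset.sum_add_distrib, Finset.mul_sum]
    have h1 : ∀ u w : Fin d → Fin n, (nchsCoeff (d + d) (Fin.append u w) : ℂ) *
        ((T : ℂ) ^ 2 * ((a (List.ofFn u) : ℂ) * (a (List.ofFn w) : ℂ))) =
        (T : ℂ) ^ 2 * ((nchsCoeff (d + d) (Fin.append u w) : ℂ) *
          ((a (List.ofFn u) : ℂ) * (a (List.ofFn w) : ℂ))) := fun u w => by ring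
    have h2 : ∀ j, (μ : ℂ) * ((T : ℂ) ^ 2 * (a (List.replicate d j) : ℂ) ^ 2) =
        (T : ℂ) ^ 2 * ((μ : ℂ) * (a (List.replicate d j) : ℂ) ^ 2) := fun j => by ring
    simp only [h1, h2]
    ring
  have hlt : 0 < μ * E - Q := by linarith
  obtain ⟨T, hT⟩ : ∃ T : ℝ, B.re + T ^ 2 * (Q - μ * E) < 0 := by
    refine ⟨Real.sqrt ((|B.re| + 1) / (μ * E - Q)), ?_⟩
    rw [Real.sq_sqrt (by positivity), ← neg_sub (μ * E) Q, mul_neg, div_mul_cancel₀ _ hlt.ne']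
    linarith [le_abs_self B.re]
  refine ⟨k, X T, hX T, fun h => ?_⟩
  have h0 := (Complex.le_def.mp (h.diag_nonneg (i := e))).1
  rw [hentry, Complex.add_re, Complex.ofReal_re, Complex.zero_re] at h0
  linarith

/-- An eigenvector, constant on the pure powers, of the inverse Gram matrix restricted to the pure
powers; its eigenvalue determines `μ_{n,d}`. -/
lemma exists_eigenvector_muConst {n : ℕ} (d : ℕ) (hn : 1 ≤ n) :
    ∃ (t : Fin n → ℝ) (c : ℝ), 0 < c ∧ 0 < ∑ j, t j ^ 2 ∧
      (∀ i, ∑ j, t j * dualWeight n d (if i = j then d else 0) = c * t i) ∧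
      (d.factorial : ℝ) * d.factorial * ((n - 1 + d + d).choose d : ℝ) / ((d + d).factorial : ℝ) =
        muConst n d * c := by
  have hdiag : dualWeight n d d = ((n - 1 + d).choose d : ℝ) := by
    simp [dualWeight, ← two_mul]
  have hoff : dualWeight n d 0 = (-1) ^ d := by simp [dualWeight]
  have hN : 0 < ((n - 1 + d).choose d : ℝ) := by
    exact_mod_cast Nat.choose_pos (Nat.le_add_left _ _)
  have hconst : (d.factorial : ℝ) * d.factorial * ((n - 1 + d + d).choose d : ℝ) /
      ((d + d).factorial : ℝ) =
      ((n - 1 + 2 * d).choose (2 * d) : ℝ) / ((n - 1 + d).choose d : ℝ) := by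
    have h1 := Nat.add_choose_mul_factorial_mul_factorial (n - 1) d
    have h2 := Nat.add_choose_mul_factorial_mul_factorial (n - 1 + d) d
    have h3 := Nat.add_choose_mul_factorial_mul_factorial (n - 1) (2 * d)
    rw [show n - 1 + d + d = n - 1 + 2 * d by ring] at h2 ⊢
    rw [← two_mul]
    rw [div_eq_div_iff (by positivity) hN.ne']
    rw [← h3] at h2
    have h4 : ((n - 1).factorial : ℝ) ≠ 0 := by positivity
    apply mul_right_cancel₀ h4
    have h2' : (((n - 1 + 2 * d).choose d * (n - 1 + d).factorial * d.factorial : ℕ) : ℝ) =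
      ((n - 1 + 2 * d).choose (2 * d) * (n - 1).factorial * (2 * d).factorial : ℕ) := by
      exact_mod_cast h2
    rw [← h1] at h2'
    push_cast at h2'
    linear_combination h2'
  have hrow : ∀ (t : Fin n → ℝ) (i : Fin n),
      ∑ j, t j * dualWeight n d (if i = j then d else 0) =
        (((n - 1 + d).choose d : ℝ) - (-1) ^ d) * t i + (-1) ^ d * ∑ j, t j := by
    intro t i
    have : ∀ j, t j * dualWeight n d (if i = j then d else 0) =
        (if i = j then (((n - 1 + d).choose d : ℝ) - (-1) ^ d) * t j else 0) +
          (-1) ^ d * t j := by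
      intro j
      split_ifs
      · rw [hdiag]; ring
      · rw [hoff]; ring
    simp [this, Finset.sum_add_distrib, ← Finset.mul_sum]
  rw [hconst]
  rcases hn.eq_or_lt with rfl | hn2
  · refine ⟨fun _ => 1, 1, one_pos, by simp, fun i => ?_, by simp [muConst]⟩
    rw [hrow]
    simp
  · rw [muConst, if_neg hn2.ne']
    by_cases hodd : Odd d
    · let p : Fin n := ⟨0, hn⟩
      let q : Fin n := ⟨1, hn2⟩
      have hpq : p ≠ q := by simp [p, q, Fin.ext_iff]
      refine ⟨Pi.single p 1 - Pi.single q 1, (n - 1 + d).choose d + 1, by positivity, ?_,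
        fun i => ?_, ?_⟩
      · refine Finset.sum_pos' (fun j _ => sq_nonneg _) ⟨p, Finset.mem_univ p, ?_⟩
        simp [hpq]
      · rw [hrow, hodd.neg_one_pow]
        simp [Finset.sum_sub_distrib]
      · rw [if_pos hodd]
        field_simp
    · refine ⟨fun _ => 1, (n - 1 + d).choose d + ((n - 1 : ℕ) : ℝ), by positivity, ?_,
        fun i => ?_, ?_⟩
      · simp; omega
      · rw [hrow, (Nat.not_odd_iff_even.mp hodd).neg_one_pow, Nat.cast_sub hn]
        simp
        ring
      · rw [if_neg hodd]
        field_simp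

/-- The constant `μ_{n,d}` is best possible: for any `μ > μ_{n,d}` the operator
inequality fails for some tuple of hermitian matrices. -/
theorem stmt_3 (n d : ℕ) (hn : 1 ≤ n) (hd : 1 ≤ d) (μ : ℝ) (hμ : μ > muConst n d) :
    ∃ (k : ℕ) (X : Fin n → Matrix (Fin k) (Fin k) ℂ),
      (∀ j, (X j).IsHermitian) ∧
      ¬ (nchs (2 * d) X - μ • ∑ j : Fin n, X j ^ (2 * d)).PosSemidef := by
  obtain ⟨t, c, hc, ht, heig, hmu⟩ := exists_eigenvector_muConst d hn
  let a : List (Fin n) → ℝ := fun l => ∑ j, t j * dualWeight n d (l.count j)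
  have ha_ofFn : ∀ w : Fin d → Fin n,
      a (List.ofFn w) = ∑ j, t j * dualWeight n d (letterCount w j) := by
    intro w
    simp only [a, letterCount_eq_count_ofFn]
  have ha_const : ∀ i, a (List.ofFn fun _ : Fin d => i) = c * t i := by
    intro i
    simp only [ha_ofFn, letterCount_const, heig]
  have ha_replicate : ∀ i, a (List.replicate d i) = c * t i := by
    intro i
    rw [← ha_const, List.ofFn_const]
  refine exists_not_posSemidef hd μ a (fun l => by simp [a]) ?_
  have hrow : ∀ u : Fin d → Fin n, ∑ w : Fin d → Fin n,
      nchsCoeff (d + d) (Fin.append u w) * (a (List.ofFn u) * a (List.ofFn w)) =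
      ∑ j, if u = fun _ => j then muConst n d * c * t j * a (List.ofFn u) else 0 := by
    intro u
    have h1 : ∀ w : Fin d → Fin n,
        nchsCoeff (d + d) (Fin.append u w) * (a (List.ofFn u) * a (List.ofFn w)) =
        ∑ j, a (List.ofFn u) * t j / ((d + d).factorial : ℝ) *
          ((∏ i, ((letterCount u i + letterCount w i).factorial : ℝ)) *
            dualWeight n d (letterCount w j)) := by
      intro w
      rw [ha_ofFn w, nchsCoeff_append, Finset.mul_sum, Finset.mul_sum]
      exact Finset.sum_congr rfl fun j _ => by ring
    rw [Finset.sum_congr rfl fun w _ => h1 w, Finset.sum_comm]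
    refine Finset.sum_congr rfl fun j _ => ?_
    rw [← Finset.mul_sum, sum_prod_factorial_mul_dualWeight, ← hmu]
    split_ifs <;> ring
  rw [Finset.sum_congr rfl fun u _ => hrow u, Finset.sum_comm]
  simp only [Finset.sum_ite_eq', Finset.mem_univ, if_true, ha_const, ha_replicate]
  rw [Finset.mul_sum]
  have h2 : ∑ j, muConst n d * c * t j * (c * t j) = muConst n d * (c ^ 2 * ∑ j, t j ^ 2) := by
    simp only [Finset.mul_sum]
    exact Finset.sum_congr rfl fun j _ => by ring
  have h3 : ∑ j, μ * (c * t j) ^ 2 = μ * (c ^ 2 * ∑ j, t j ^ 2) := by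
    simp only [Finset.mul_sum]
    exact Finset.sum_congr rfl fun j _ => by ring
  rw [h2, h3]
  exact mul_lt_mul_of_pos_right hμ (by positivity)
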